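/- Let P ⊂ R^n be a polytope with nonempty interior, F a facet of P, and F_1, ..., F_ℓ the facets adjacent to F (sharing a ridge with F). Suppose that for each i, all vertices of P not in F lie in F_i. If there were two distinct vertices v, w of P with v, w ∉ F, then the segment [v,w] would be contained in F_1 ∩ ... ∩ F_ℓ, forcing the (bounded) facet F to contain the line through v and w — a contradiction. Hence at most one vertex of P lies outside F, i.e., P is a pyramid over F. -/

import Mathlib

open Filter Topology in
lemma pert {E : Type*} (t : Finset E) (a b : E → ℝ) (ha : ∀ y ∈ t, a y ≤ 0)
    (hab : ∀ y ∈ t, a y = 0 → b y = 0) :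
    ∃ ε : ℝ, 0 < ε ∧ ∀ y ∈ t, a y + ε * b y ≤ 0 ∧ a y - ε * b y ≤ 0 := by
  have key : ∀ᶠ ε : ℝ in 𝓝[>] 0, ∀ y ∈ t, a y + ε * b y ≤ 0 ∧ a y - ε * b y ≤ 0 := by
    rw [Finset.eventually_all]
    intro y hy
    rcases (ha y hy).lt_or_eq with h | h
    · apply nhdsWithin_le_nhds
      have h1 : Tendsto (fun ε : ℝ => a y + ε * b y) (𝓝 0) (𝓝 (a y + 0 * b y)) :=
        Continuous.tendsto (by fun_prop) 0
      have h2 : Tendsto (fun ε : ℝ => a y - ε * b y) (𝓝 0) (𝓝 (a y - 0 * b y)) :=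
        Continuous.tendsto (by fun_prop) 0
      filter_upwards [h1.eventually_lt_const (show a y + 0 * b y < 0 by simpa using h),
        h2.eventually_lt_const (show a y - 0 * b y < 0 by simpa using h)] with e h1 h2
      exact ⟨h1.le, h2.le⟩
    · have := hab y hy h
      simp [h, this]
  obtain ⟨ε, h1, h2⟩ := (key.and self_mem_nhdsWithin).exists
  exact ⟨ε, h2, h1⟩

lemma cone_facet {E : Type*} [NormedAddCommGroup E] [NormedSpace ℝ E] [FiniteDimensional ℝ E]
    (T : Finset E) (hT : Submodule.span ℝ (T : Set E) = ⊤) (hne : T.Nonempty)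
    (L : E →L[ℝ] ℝ) (hL : ∀ z ∈ T, 0 < L z) (q : E) (hq : q ≠ 0) :
    ∃ φ : E →L[ℝ] ℝ, (∀ z ∈ T, φ z ≤ 0) ∧ (∃ z ∈ T, φ z < 0) ∧ φ q ≠ 0 ∧
      Module.finrank ℝ E ≤ Module.finrank ℝ (Submodule.span ℝ {z | z ∈ T ∧ φ z = 0}) + 1 := by
  by_contra! hcon
  set X : E := ∑ z ∈ T, z with hX
  let D : Set (E →L[ℝ] ℝ) := {φ | (∀ z ∈ T, φ z ≤ 0) ∧ φ X = -1}
  have hDconv : Convex ℝ D := by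
    rintro φ ⟨h1, h2⟩ ψ ⟨h3, h4⟩ a b ha hb hab
    refine ⟨fun z hz => ?_, ?_⟩
    · have := mul_nonpos_of_nonneg_of_nonpos ha (h1 z hz)
      have := mul_nonpos_of_nonneg_of_nonpos hb (h3 z hz)
      simp; linarith
    · simp [h2, h4]; linarith
  have hDcomp : IsCompact D := by
    let ev : (E →L[ℝ] ℝ) →ₗ[ℝ] (T → ℝ) :=
      { toFun := fun φ z => φ z
        map_add' := fun _ _ => rfl
        map_smul' := fun _ _ => rfl }
    have hinj : LinearMap.ker ev = ⊥ := by
      rw [LinearMap.ker_eq_bot']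
      intro φ hφ
      have h : (φ : E →ₗ[ℝ] ℝ) = 0 := by
        apply LinearMap.ext_on hT
        intro z hz
        exact congrFun hφ ⟨z, hz⟩
      ext x
      exact LinearMap.congr_fun h x
    have hemb := LinearMap.isClosedEmbedding_of_injective hinj
    have hc : IsCompact (ev ⁻¹' (Set.Icc (fun _ => -1) (fun _ => 0))) :=
      hemb.isCompact_preimage isCompact_Icc
    refine hc.of_isClosed_subset ?_ ?_
    · have : D = (⋂ z ∈ T, {φ : E →L[ℝ] ℝ | φ z ≤ 0}) ∩ {φ | φ X = -1} := by
        ext φ; simp [D]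
      rw [this]
      refine IsClosed.inter (isClosed_biInter fun z _ => isClosed_le (by fun_prop) (by fun_prop))
        (isClosed_eq (by fun_prop) (by fun_prop))
    · rintro φ ⟨h1, h2⟩
      refine ⟨fun z => ?_, fun z => h1 z z.2⟩
      have h3 : ∑ z ∈ T, (-φ z) = 1 := by
        rw [Finset.sum_neg_distrib, ← map_sum, ← hX, h2]; simp
      have h4 := Finset.single_le_sum (f := fun z => -φ z)
        (fun z hz => by simpa using h1 z hz) z.2
      change -1 ≤ φ z
      linarith
  -- existence of negative
  have hneg : ∀ φ ∈ D, ∃ z ∈ T, φ z < 0 := by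
    rintro φ ⟨h1, h2⟩
    by_contra! h
    have : φ X = 0 := by
      rw [hX, map_sum]
      exact Finset.sum_eq_zero fun z hz => le_antisymm (h1 z hz) (h z hz)
    linarith
  have hext : ∀ φ ∈ D.extremePoints ℝ, φ q = 0 := by
    intro φ hφ
    have hφD := hφ.1
    by_contra hφq
    have hlt := hcon φ hφD.1 (hneg φ hφD) hφq
    set W := Submodule.span ℝ {z | z ∈ T ∧ φ z = 0} with hW
    have hW2 : W ⊔ Submodule.span ℝ {X} < ⊤ := by
      rw [lt_top_iff_ne_top]
      intro h
      have h1 := Submodule.finrank_add_le_finrank_add_finrank W (Submodule.span ℝ {X})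
      have h2 := finrank_span_le_card (R := ℝ) ({X} : Set E)
      rw [h, finrank_top] at h1
      simp at h2
      omega
    obtain ⟨ψ, hψ0, hψ⟩ := Submodule.exists_le_ker_of_lt_top _ hW2
    have hψX : ψ X = 0 := hψ (Submodule.mem_sup_right (Submodule.mem_span_singleton_self X))
    obtain ⟨ε, hε, h⟩ := pert T (fun z => φ z) (fun z => ψ z) hφD.1 (fun z hz hz0 =>
      hψ (Submodule.mem_sup_left (Submodule.subset_span ⟨hz, hz0⟩)))
    let ψc : E →L[ℝ] ℝ := LinearMap.toContinuousLinearMap ψ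
    have hψc : ∀ x, ψc x = ψ x := fun x => rfl
    have m1 : φ + ε • ψc ∈ D :=
      ⟨fun z hz => by simpa [hψc] using (h z hz).1, by simp [hψc, hψX, hφD.2]⟩
    have m2 : φ - ε • ψc ∈ D :=
      ⟨fun z hz => by simpa [hψc] using (h z hz).2, by simp [hψc, hψX, hφD.2]⟩
    have hseg : φ ∈ openSegment ℝ (φ + ε • ψc) (φ - ε • ψc) := by
      refine ⟨1/2, 1/2, by norm_num, by norm_num, by norm_num, ?_⟩
      module
    have heq := hφ.2 m1 m2 hseg
    apply hψ0
    ext x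
    have := DFunLike.congr_fun heq x
    simp [hψc] at this
    rcases this with h | h
    · exact absurd h hε.ne'
    · simpa using h
  have hall : ∀ φ ∈ D, φ q = 0 := by
    intro φ hφ
    have hKM := closure_convexHull_extremePoints hDcomp hDconv
    rw [← hKM] at hφ
    have hsub : closure (convexHull ℝ (D.extremePoints ℝ)) ⊆ {φ : E →L[ℝ] ℝ | φ q = 0} := by
      apply closure_minimal
      · apply convexHull_min hext
        intro a ha b hb r s _ _ _
        have ha' : a q = 0 := ha
        have hb' : b q = 0 := hb
        change (r • a + s • b) q = 0
        simp [ha', hb']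
      · exact isClosed_eq (by fun_prop) (by fun_prop)
    exact hsub hφ
  have hLX : 0 < L X := by
    rw [hX, map_sum]; exact Finset.sum_pos hL hne
  let φ0 : E →L[ℝ] ℝ := (-(L X)⁻¹) • L
  have hφ0 : ∀ x, φ0 x = -(L X)⁻¹ * L x := fun x => rfl
  have h0n : ∀ z ∈ T, φ0 z < 0 := fun z hz => by
    rw [hφ0]
    have := mul_pos (inv_pos.2 hLX) (hL z hz)
    linarith
  have h0X : φ0 X = -1 := by
    rw [hφ0]; field_simp
  have h0D : φ0 ∈ D := ⟨fun z hz => (h0n z hz).le, h0X⟩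
  obtain ⟨ψ1, hψ1⟩ : ∃ ψ : E →L[ℝ] ℝ, ψ q ≠ 0 := by
    obtain ⟨g, -, hg⟩ := exists_dual_vector ℝ q (norm_ne_zero_iff.2 hq)
    exact ⟨g, by rw [hg]; simpa using hq⟩
  let ψ := ψ1 + (ψ1 X) • φ0
  have hψX : ψ X = 0 := by simp [ψ, h0X]
  have hψq : ψ q ≠ 0 := by simpa [ψ, hall φ0 h0D] using hψ1
  obtain ⟨ε, hε, h⟩ := pert T (fun z => φ0 z) (fun z => ψ z) h0D.1
    (fun z hz hz0 => absurd hz0 (h0n z hz).ne)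
  have m1 : φ0 + ε • ψ ∈ D :=
      ⟨fun z hz => by simpa using (h z hz).1, by simp [hψX, h0X]⟩
  have := hall _ m1
  simp [hall φ0 h0D, hψq, hε.ne'] at this

/-- If `F` is a facet of a full-dimensional polytope `P` such that every facet
adjacent to `F` contains all vertices of `P` outside `F`, then `P` is a pyramid
over `F`: exactly one vertex of `P` lies outside `F`. -/
theorem pyramid_over_facet (n : ℕ) (hn : 1 ≤ n)
    (s : Finset (Fin n → ℝ)) (P : Set (Fin n → ℝ))
    (hP : P = convexHull ℝ (s : Set (Fin n → ℝ)))
    (hint : (interior P).Nonempty)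
    (F : Set (Fin n → ℝ)) (hF : IsExposed ℝ P F) (hFp : F ≠ P)
    (hFd : Module.finrank ℝ (vectorSpan ℝ F) = n - 1)
    (hadj : ∀ F' : Set (Fin n → ℝ), IsExposed ℝ P F' → F' ≠ P →
      Module.finrank ℝ (vectorSpan ℝ F') = n - 1 →
      Module.finrank ℝ (vectorSpan ℝ (F ∩ F')) = n - 2 →
      Set.extremePoints ℝ P \ F ⊆ F') :
    ∃ p, Set.extremePoints ℝ P \ F = {p} := by
  classical
  have hPcomp : IsCompact P := by
    rw [hP]; exact s.finite_toSet.isCompact_convexHull ℝ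
  have hPconv : Convex ℝ P := by rw [hP]; exact convex_convexHull ℝ _
  have hFconv : Convex ℝ F := hF.convex hPconv
  have hFcomp : IsCompact F := hF.isCompact hPcomp
  have hexts : Set.extremePoints ℝ P ⊆ s := by
    rw [hP]; exact extremePoints_convexHull_subset
  obtain ⟨v, hv, hvF⟩ : (Set.extremePoints ℝ P \ F).Nonempty := by
    by_contra hemp
    have hsub : Set.extremePoints ℝ P ⊆ F := by
      intro x hx
      by_contra hxF
      exact hemp ⟨x, hx, hxF⟩
    apply hFp
    apply Set.Subset.antisymm hF.subset
    rw [← closure_convexHull_extremePoints hPcomp hPconv]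
    exact closure_minimal (convexHull_min hsub hFconv) hFcomp.isClosed
  -- the case `n = 1`
  rcases Nat.lt_or_ge n 2 with hn1 | hn2
  · have hn1 : n = 1 := by omega
    subst hn1
    have := hadj ∅ isExposed_empty ?_ ?_ ?_ ⟨hv, hvF⟩
    · exact absurd this (Set.notMem_empty v)
    · rintro rfl
      exact hv.1
    · simp
    · simp
  refine ⟨v, Set.Subset.antisymm ?_ (by rintro _ rfl; exact ⟨hv, hvF⟩)⟩
  rintro w ⟨hw, hwF⟩
  by_contra hwv
  have hwv : w ≠ v := hwv
  have hFne : F.Nonempty := by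
    rw [Set.nonempty_iff_ne_empty]
    rintro rfl
    rw [vectorSpan_empty, finrank_bot] at hFd
    omega
  obtain ⟨L, hFL⟩ := hF hFne
  obtain ⟨x0, hx0⟩ := hFne
  set M := L x0 with hM
  have hx0' : x0 ∈ P ∧ ∀ y ∈ P, L y ≤ M := by
    have h := hx0; rw [hFL] at h; exact h
  have hFmem : ∀ x, x ∈ F ↔ x ∈ P ∧ L x = M := by
    intro x
    constructor
    · intro hx
      have h := hx; rw [hFL] at h
      exact ⟨h.1, le_antisymm (hx0'.2 x h.1) (h.2 x0 hx0'.1)⟩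
    · rintro ⟨h1, h2⟩
      rw [hFL]
      exact ⟨h1, fun y hy => by rw [h2]; exact hx0'.2 y hy⟩
  have hlt : ∀ x ∈ P, x ∉ F → L x < M := by
    intro x hx hxF
    refine lt_of_le_of_ne (hx0'.2 x hx) fun h => hxF ((hFmem x).2 ⟨hx, h⟩)
  have hsP : ∀ y ∈ s, y ∈ P := fun y hy => by rw [hP]; exact subset_convexHull ℝ _ hy
  have hvM := hlt v hv.1 hvF
  let t := s.filter (· ∈ F)
  have htF : ∀ y ∈ t, y ∈ F := fun y hy => (Finset.mem_filter.1 hy).2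
  have hFt : F ⊆ convexHull ℝ (t : Set (Fin n → ℝ)) := by
    conv_lhs => rw [← closure_convexHull_extremePoints hFcomp hFconv]
    refine closure_minimal (convexHull_mono ?_) (t.finite_toSet.isClosed_convexHull ℝ)
    intro x hx
    have := hexts (hF.isExtreme.extremePoints_subset_extremePoints hx)
    exact Finset.mem_coe.2 (Finset.mem_filter.2 ⟨this, hx.1⟩)
  have htne : t.Nonempty := by
    have : (convexHull ℝ (t : Set (Fin n → ℝ))).Nonempty := ⟨x0, hFt hx0⟩
    simpa using this
  let T := t.image (fun y => y - v)
  have hLT : ∀ y ∈ t, 0 < L (y - v) := by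
    intro y hy
    rw [map_sub, ((hFmem y).1 (htF y hy)).2]
    linarith
  have hspan : Submodule.span ℝ (T : Set (Fin n → ℝ)) = ⊤ := by
    set Sp := Submodule.span ℝ (T : Set (Fin n → ℝ)) with hSp
    have h1 : ∀ x ∈ F, x - v ∈ Sp := by
      intro x hx
      have hc : Convex ℝ {x | x - v ∈ Sp} := by
        intro a ha b hb α β hα hβ hαβ
        have ha' : a - v ∈ Sp := ha
        have hb' : b - v ∈ Sp := hb
        change α • a + β • b - v ∈ Sp
        have : α • a + β • b - v = α • (a - v) + β • (b - v) := by
          have : v = (α + β) • v := by rw [hαβ, one_smul]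
          nth_rewrite 1 [this]
          module
        rw [this]
        exact Sp.add_mem (Sp.smul_mem _ ha') (Sp.smul_mem _ hb')
      refine convexHull_min ?_ hc (hFt hx)
      intro y hy
      exact Submodule.subset_span (Finset.mem_coe.2 (Finset.mem_image_of_mem _ hy))
    have h2 : vectorSpan ℝ F ≤ Sp := by
      rw [vectorSpan_def, Submodule.span_le]
      rintro _ ⟨a, ha, b, hb, rfl⟩
      have := Sp.sub_mem (h1 a ha) (h1 b hb)
      simpa using this
    have h3 : vectorSpan ℝ F ≤ LinearMap.ker (L : (Fin n → ℝ) →ₗ[ℝ] ℝ) := by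
      rw [vectorSpan_def, Submodule.span_le]
      rintro _ ⟨a, ha, b, hb, rfl⟩
      simp [((hFmem a).1 ha).2, ((hFmem b).1 hb).2]
    have h4 : vectorSpan ℝ F < Sp := by
      refine lt_of_le_of_ne h2 fun h => ?_
      have h5 : x0 - v ∈ vectorSpan ℝ F := by rw [h]; exact h1 x0 hx0
      have h6 := h3 h5
      simp at h6
      linarith
    have h5 := Submodule.finrank_lt_finrank_of_lt h4
    apply Submodule.eq_top_of_finrank_eq
    have h6 := Submodule.finrank_le Sp
    simp at h6 ⊢
    omega
  obtain ⟨φ, hφ1, hφ2, hφq, hφd⟩ := cone_facet T hspan (htne.image _) L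
    (by intro z hz; obtain ⟨y, hy, rfl⟩ := Finset.mem_image.1 hz; exact hLT y hy)
    (w - v) (sub_ne_zero.2 hwv)
  have hφt : ∀ y ∈ t, φ y ≤ φ v := by
    intro y hy
    have := hφ1 _ (Finset.mem_image_of_mem _ hy)
    rw [map_sub] at this
    linarith
  obtain ⟨y2, hy2t, hy2⟩ : ∃ y ∈ t, φ y < φ v := by
    obtain ⟨z, hz, h⟩ := hφ2
    obtain ⟨y, hy, rfl⟩ := Finset.mem_image.1 hz
    refine ⟨y, hy, ?_⟩
    rw [map_sub] at h
    linarith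
  -- rotate
  obtain ⟨y0, hy0, hmax⟩ := Finset.exists_max_image (s.filter (· ∉ F))
    (fun y => (φ y - φ v) / (M - L y)) ⟨v, Finset.mem_filter.2 ⟨hexts hv, hvF⟩⟩
  obtain ⟨hy0s, hy0F⟩ := Finset.mem_filter.1 hy0
  set τ := (φ y0 - φ v) / (M - L y0) with hτ
  have hy0M := hlt y0 (hsP y0 hy0s) hy0F
  let f : (Fin n → ℝ) →L[ℝ] ℝ := φ + τ • L
  have hf : ∀ x, f x = φ x + τ * L x := fun x => rfl
  set c := φ v + τ * M with hc
  have hfs : ∀ y ∈ s, f y ≤ c := by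
    intro y hy
    rw [hf]
    by_cases hyF : y ∈ F
    · rw [((hFmem y).1 hyF).2]
      have := hφt y (Finset.mem_filter.2 ⟨hy, hyF⟩)
      linarith
    · have h1 := hmax y (Finset.mem_filter.2 ⟨hy, hyF⟩)
      have h2 := hlt y (hsP y hy) hyF
      have h3 : (φ y - φ v) / (M - L y) ≤ τ := h1
      rw [div_le_iff₀ (by linarith)] at h3
      linarith
  have hfP : ∀ x ∈ P, f x ≤ c := by
    intro x hx
    rw [hP] at hx
    exact convexHull_min (t := {x | f x ≤ c}) hfs (convex_halfSpace_le f.toLinearMap.isLinear c) hx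
  have hfy0 : f y0 = c := by
    have : τ * (M - L y0) = φ y0 - φ v := by
      rw [hτ]; field_simp [show M - L y0 ≠ 0 by linarith]
    rw [hf]; linarith
  set W := Submodule.span ℝ {z | z ∈ T ∧ φ z = 0} with hW
  rw [Module.finrank_fin_fun] at hφd
  obtain ⟨y1, hy1t, hy1⟩ : ∃ y ∈ t, φ y = φ v := by
    by_contra! hno
    have hbot : W = ⊥ := by
      rw [hW, Submodule.span_eq_bot]
      rintro z ⟨hz, hz0⟩
      obtain ⟨y, hy, rfl⟩ := Finset.mem_image.1 hz
      rw [map_sub] at hz0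
      exact absurd (by linarith) (hno y hy)
    rw [hbot, finrank_bot] at hφd
    omega
  have hy1F := htF y1 hy1t
  have hy1M := ((hFmem y1).1 hy1F)
  have hfy1 : f y1 = c := by rw [hf, hy1, hy1M.2]
  set F' : Set (Fin n → ℝ) := f.toExposed P with hF'
  have hF'mem : ∀ x, x ∈ F' ↔ x ∈ P ∧ f x = c := by
    intro x
    constructor
    · rintro ⟨h1, h2⟩
      exact ⟨h1, le_antisymm (hfP x h1) (by rw [← hfy1]; exact h2 y1 hy1M.1)⟩
    · rintro ⟨h1, h2⟩
      exact ⟨h1, fun y hy => by rw [h2]; exact hfP y hy⟩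
  have hkerle : ∀ (A : Set (Fin n → ℝ)) (g : (Fin n → ℝ) →L[ℝ] ℝ) (k : ℝ), (∀ x ∈ A, g x = k) →
      vectorSpan ℝ A ≤ LinearMap.ker (g : (Fin n → ℝ) →ₗ[ℝ] ℝ) := by
    intro A g k h
    rw [vectorSpan_def, Submodule.span_le]
    rintro _ ⟨a, ha, b, hb, rfl⟩
    simp [h a ha, h b hb]
  have hkerd : ∀ (g : (Fin n → ℝ) →L[ℝ] ℝ) (x : Fin n → ℝ), g x ≠ 0 →
      Module.finrank ℝ (LinearMap.ker (g : (Fin n → ℝ) →ₗ[ℝ] ℝ)) < n := by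
    intro g x hx
    have : LinearMap.ker (g : (Fin n → ℝ) →ₗ[ℝ] ℝ) < ⊤ := by
      rw [lt_top_iff_ne_top]
      intro h
      have : x ∈ LinearMap.ker (g : (Fin n → ℝ) →ₗ[ℝ] ℝ) := by rw [h]; trivial
      exact hx (by simpa using this)
    simpa using Submodule.finrank_lt_finrank_of_lt (this)
  set U := vectorSpan ℝ (F ∩ F') with hU
  have hy1F' : y1 ∈ F' := (hF'mem y1).2 ⟨hy1M.1, hfy1⟩
  have hy0F' : y0 ∈ F' := (hF'mem y0).2 ⟨hsP y0 hy0s, hfy0⟩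
  have hUL : U ≤ LinearMap.ker (L : (Fin n → ℝ) →ₗ[ℝ] ℝ) :=
    hkerle _ L M fun x hx => ((hFmem x).1 hx.1).2
  have hUφ : U ≤ LinearMap.ker (φ : (Fin n → ℝ) →ₗ[ℝ] ℝ) :=
    hkerle _ φ (φ v) fun x hx => by
      have h1 := ((hFmem x).1 hx.1).2
      have h2 := ((hF'mem x).1 hx.2).2
      rw [hf, h1] at h2
      linarith
  have hUlow : n - 2 ≤ Module.finrank ℝ U := by
    have h1 : W ≤ U ⊔ Submodule.span ℝ {y1 - v} := by
      rw [hW, Submodule.span_le]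
      rintro z ⟨hz, hz0⟩
      obtain ⟨y, hy, rfl⟩ := Finset.mem_image.1 hz
      have hyF := (hFmem y).1 (htF y hy)
      have hyF' : y ∈ F' := (hF'mem y).2 ⟨hyF.1, by
        rw [map_sub] at hz0
        rw [hf, hyF.2]; linarith⟩
      have h2 : y - y1 ∈ U := vsub_mem_vectorSpan ℝ ⟨htF y hy, hyF'⟩ ⟨hy1F, hy1F'⟩
      have h3 : y - v = (y - y1) + (y1 - v) := by abel
      change y - v ∈ U ⊔ Submodule.span ℝ {y1 - v}
      rw [h3]
      exact Submodule.add_mem_sup h2 (Submodule.mem_span_singleton_self _)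
    have h2 := Submodule.finrank_mono h1
    have h3 := Submodule.finrank_add_le_finrank_add_finrank U (Submodule.span ℝ {y1 - v})
    have h4 := finrank_span_le_card (R := ℝ) ({y1 - v} : Set (Fin n → ℝ))
    simp at h4
    omega
  have hUup : Module.finrank ℝ U ≤ n - 2 := by
    have h1 : U < LinearMap.ker (φ : (Fin n → ℝ) →ₗ[ℝ] ℝ) := by
      refine lt_of_le_of_ne hUφ fun h => ?_
      have h2 : y1 - v ∈ U := by rw [h]; simp [hy1]
      have h3 := hUL h2
      have h4 := hLT y1 hy1t
      exact h4.ne' h3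
    have h2 := Submodule.finrank_lt_finrank_of_lt h1
    have h3 := hkerd φ (w - v) hφq
    omega
  have hF'low : n - 1 ≤ Module.finrank ℝ (vectorSpan ℝ F') := by
    have h1 : U < vectorSpan ℝ F' := by
      refine lt_of_le_of_ne (vectorSpan_mono ℝ Set.inter_subset_right) fun h => ?_
      have h2 : y0 - y1 ∈ U := by rw [h]; exact vsub_mem_vectorSpan ℝ hy0F' hy1F'
      have h3 : L (y0 - y1) = 0 := hUL h2
      rw [map_sub, hy1M.2] at h3
      linarith
    have h2 := Submodule.finrank_lt_finrank_of_lt h1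
    omega
  have hy2M := (hFmem y2).1 (htF y2 hy2t)
  have hfy2 : f y2 < c := by rw [hf, hy2M.2]; linarith
  have hF'up : Module.finrank ℝ (vectorSpan ℝ F') ≤ n - 1 := by
    have h1 := Submodule.finrank_mono (hkerle F' f c fun x hx => ((hF'mem x).1 hx).2)
    have h2 := hkerd f (y2 - y1) (by rw [map_sub]; linarith)
    omega
  have hsub := hadj F' ContinuousLinearMap.toExposed.isExposed
    (fun h => by
      have : y2 ∈ F' := by rw [h]; exact hy2M.1
      linarith [((hF'mem y2).1 this).2])
    (le_antisymm hF'up hF'low) (le_antisymm hUup hUlow)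
  have hv' := ((hF'mem v).1 (hsub ⟨hv, hvF⟩)).2
  have hw' := ((hF'mem w).1 (hsub ⟨hw, hwF⟩)).2
  rw [hf] at hv' hw'
  have hτ0 : τ = 0 := by
    have : τ * (M - L v) = 0 := by linarith
    rcases mul_eq_zero.1 this with h | h
    · exact h
    · linarith
  apply hφq
  rw [map_sub]
  rw [hc, hτ0] at hw'
  linarith
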